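/- Tangency of the monomial approximation (the 'best local monomial approximation' property of Lemma 1): let E be a real normed vector space, J a finite nonempty index set, x⁰ ∈ E, and u_j : E → ℝ functions that are differentiable at x⁰ with u_j(x⁰) > 0 for all j. Let g = ∑_j u_j, let γ_j = u_j(x⁰)/g(x⁰), and define g̃(x) = ∏_j (u_j(x)/γ_j)^{γ_j} (real powers). Then g̃ is differentiable at x⁰ and its Fréchet derivative at x⁰ equals that of g: fderiv ℝ g̃ x⁰ = fderiv ℝ g x⁰. -/

import Mathlib

/-- Tangency of the monomial approximation (the 'best local monomial approximation'
property of Lemma 1): with `g = ∑_j u_j`, `γ_j = u_j(x⁰)/g(x⁰)` and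
`g̃(x) = ∏_j (u_j(x)/γ_j)^{γ_j}`, the function `g̃` is differentiable at `x⁰` and its
Fréchet derivative at `x⁰` equals that of `g`. -/
theorem monomial_approximation_tangency
    {E : Type*} [NormedAddCommGroup E] [NormedSpace ℝ E]
    (J : Type*) [Fintype J] [Nonempty J]
    (x0 : E) (u : J → E → ℝ)
    (hdiff : ∀ j, DifferentiableAt ℝ (u j) x0)
    (hpos : ∀ j, 0 < u j x0) :
    DifferentiableAt ℝ
      (fun x => ∏ j, (u j x / (u j x0 / ∑ i, u i x0)) ^ (u j x0 / ∑ i, u i x0)) x0 ∧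
    fderiv ℝ
        (fun x => ∏ j, (u j x / (u j x0 / ∑ i, u i x0)) ^ (u j x0 / ∑ i, u i x0)) x0
      = fderiv ℝ (fun x => ∑ j, u j x) x0 := by
  classical
  have hS : 0 < ∑ i, u i x0 := Finset.sum_pos (fun i _ => hpos i) Finset.univ_nonempty
  set S := ∑ i, u i x0 with hSdef
  have hsum : ∑ i, u i x0 / S = 1 := by
    rw [← Finset.sum_div, ← hSdef, div_self hS.ne']
  have hbase (j : J) : u j x0 / (u j x0 / S) = S := by
    have := (hpos j).ne'
    field_simp
  have hfactor (j : J) : HasFDerivAt (fun x => (u j x / (u j x0 / S)) ^ (u j x0 / S))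
      (S ^ (u j x0 / S - 1) • fderiv ℝ (u j) x0) x0 := by
    have hγ : u j x0 / S ≠ 0 := (div_pos (hpos j) hS).ne'
    have h := ((hdiff j).hasFDerivAt.mul_const (u j x0 / S)⁻¹).rpow_const
      (p := u j x0 / S) (Or.inl (by rw [← div_eq_mul_inv, hbase]; exact hS.ne'))
    simp only [← div_eq_mul_inv, hbase, smul_smul] at h
    convert h using 2
    exact (mul_div_cancel_left₀ _ hγ).symm
  have hcoeff (j : J) :
      (∏ i ∈ Finset.univ.erase j, (u i x0 / (u i x0 / S)) ^ (u i x0 / S)) *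
        S ^ (u j x0 / S - 1) = 1 := by
    simp only [hbase]
    rw [← Real.rpow_sum_of_pos hS, ← Real.rpow_add hS]
    have := Finset.sum_erase_add Finset.univ (fun i => u i x0 / S) (Finset.mem_univ j)
    rw [← add_sub_assoc, this, hsum, sub_self, Real.rpow_zero]
  have hprod := HasFDerivAt.finsetProd (u := Finset.univ) (fun j _ => hfactor j)
  simp only [smul_smul, hcoeff, one_smul] at hprod
  have hg := HasFDerivAt.fun_sum (u := Finset.univ) (fun j _ => (hdiff j).hasFDerivAt)
  exact ⟨hprod.differentiableAt, hprod.fderiv.trans hg.fderiv.symm⟩
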